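/- arXiv:1904.11606 — 2 statements merged into one kernel-verified Lean document; each statement's English description precedes it below -/
import Mathlib

section
/- Let |V| = n and let q ≥ 1 be an integer with n ≥ 30(q+1). Then there exist a set W ⊆ V with |W| = q and pairwise disjoint nonempty sets V_1, …, V_{q+1} whose union is V ∖ W, such that: (1) max_{1≤i≤q+1} |V_i| ≤ 9·min_{1≤i≤q+1} |V_i| + 1; (2) for all i ≠ j there exists w ∈ W such that either (V_i ⊆ S_w and V_j ⊆ T_w) or (V_i ⊆ T_w and V_j ⊆ S_w); (3) for every subset U ⊆ W, the set V_U = (⋂_{w∈U} S_w) ∩ (⋂_{w∈W∖U} T_w) is contained in V_i for some i ∈ {1, …, q+1}. (This is the existence content of Lemma 3.2, obtained by the paper's recursive splitting procedure using Lemma 3.1.) -/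
open Finset in
lemma aux_card {V : Type*} [DecidableEq V] (R : V → V → Prop) [DecidableRel R]
    (hirr : ∀ v, ¬ R v v)
    (htour : ∀ u v : V, u ≠ v → (R u v ∧ ¬ R v u) ∨ (R v u ∧ ¬ R u v))
    (A : Finset V) (v : V) (hv : v ∈ A) :
    (A.filter (fun u => R u v)).card + (A.filter (fun u => R v u)).card + 1 = A.card := by
  rw [← Finset.card_erase_add_one hv, ← Finset.card_union_of_disjoint]
  · congr 2
    ext x
    simp only [mem_union, mem_filter, mem_erase]
    by_cases hx : x = v
    · subst hx; simp [hirr]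
    · have := htour x v hx
      tauto
  · rw [Finset.disjoint_left]
    intro x h1 h2
    simp only [mem_filter] at h1 h2
    by_cases hx : x = v
    · subst hx; exact hirr _ h1.2
    · have := htour x v hx
      tauto

open Finset in
lemma aux_low {V : Type*} [DecidableEq V] (R : V → V → Prop) [DecidableRel R]
    (hirr : ∀ v, ¬ R v v)
    (htour : ∀ u v : V, u ≠ v → (R u v ∧ ¬ R v u) ∨ (R v u ∧ ¬ R u v))
    (X : Finset V) (k : ℕ) (hk : 1 ≤ k) :
    (X.filter (fun v => (X.filter (fun u => R v u)).card < k)).card ≤ 2 * k - 1 := by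
  set A := X.filter (fun v => (X.filter (fun u => R v u)).card < k) with hA
  rcases A.eq_empty_or_nonempty with h | h
  · simp [h]
  have hsum : ∑ v ∈ A, (A.filter (fun u => R u v)).card
      = ∑ v ∈ A, (A.filter (fun u => R v u)).card := by
    simp only [Finset.card_filter]
    exact Finset.sum_comm
  obtain ⟨v, hv, hle⟩ := Finset.exists_le_of_sum_le h hsum.le
  have h1 := aux_card R hirr htour A v hv
  have h2 : (A.filter (fun u => R v u)).card ≤ (X.filter (fun u => R v u)).card :=
    Finset.card_le_card (Finset.filter_subset_filter _ (Finset.filter_subset _ _))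
  have h3 := (Finset.mem_filter.1 hv).2
  omega

open Finset in
lemma aux_split {V : Type*} [DecidableEq V] (R : V → V → Prop) [DecidableRel R]
    (hirr : ∀ v, ¬ R v v)
    (htour : ∀ u v : V, u ≠ v → (R u v ∧ ¬ R v u) ∨ (R v u ∧ ¬ R u v))
    (X : Finset V) (k : ℕ) (hk : 1 ≤ k) (hX : 4 * k ≤ X.card + 1) :
    ∃ w ∈ X, k ≤ (X.filter (fun u => R u w)).card ∧ k ≤ (X.filter (fun u => R w u)).card := by
  by_contra! hcon
  have h1 := aux_low R hirr htour X k hk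
  have h2 := aux_low (fun u v => R v u) hirr
    (fun u v h => (htour u v h).symm) X k hk
  have h3 : X ⊆ X.filter (fun v => (X.filter (fun u => R v u)).card < k) ∪
      X.filter (fun v => (X.filter (fun u => R u v)).card < k) := by
    intro v hv
    have := hcon v hv
    simp only [mem_union, mem_filter, hv, true_and]
    by_contra! h
    have := this h.2
    omega
  have h4 := (Finset.card_le_card h3).trans (Finset.card_union_le _ _)
  omega

open Finset in
lemma aux_main {V : Type*} [Fintype V] [DecidableEq V]
    (R : V → V → Prop) [DecidableRel R]
    (hirr : ∀ v, ¬ R v v)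
    (htour : ∀ u v : V, u ≠ v → (R u v ∧ ¬ R v u) ∨ (R v u ∧ ¬ R u v))
    (q : ℕ) (hn : 30 * (q + 1) ≤ Fintype.card V) :
    ∃ (W : Finset V) (P : Fin (q + 1) → Finset V),
      W.card = q ∧
      (∀ i, (P i).Nonempty) ∧
      (∀ x, (∃ i, x ∈ P i) ↔ x ∉ W) ∧
      (∀ i j, (P i).card ≤ 9 * (P j).card + 1) ∧
      (∀ i j, i ≠ j → ∃ w ∈ W,
        ((∀ x ∈ P i, R x w) ∧ (∀ x ∈ P j, R w x)) ∨
        ((∀ x ∈ P i, R w x) ∧ (∀ x ∈ P j, R x w))) := by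
  induction q with
  | zero =>
    refine ⟨∅, fun _ => Finset.univ, rfl, fun _ => ?_, by simp, fun _ _ => by dsimp only; omega, ?_⟩
    · rw [← Finset.card_pos, Finset.card_univ]; omega
    · intro i j h; exact absurd (Fin.ext (by omega)) h
  | succ q ih =>
    obtain ⟨W, P, hW, hne, hcov, hbal, hsep⟩ := ih (by omega)
    obtain ⟨m, -, hm⟩ := Finset.exists_max_image (Finset.univ : Finset (Fin (q + 1)))
      (fun i => (P i).card) ⟨0, Finset.mem_univ _⟩
    have hbig : 3 ≤ (P m).card := by
      by_contra! hlt
      have h1 : (Finset.univ : Finset V) ⊆ W ∪ Finset.univ.biUnion P := by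
        intro x _
        by_cases hx : x ∈ W
        · simp [hx]
        · obtain ⟨i, hi⟩ := (hcov x).2 hx
          exact Finset.mem_union_right _ (Finset.mem_biUnion.2 ⟨i, Finset.mem_univ _, hi⟩)
      have h2 := (Finset.card_le_card h1).trans (Finset.card_union_le _ _)
      have h3 := Finset.card_biUnion_le_card_mul (Finset.univ : Finset (Fin (q+1))) P 2
        (fun i _ => by have := hm i (Finset.mem_univ _); omega)
      simp only [Finset.card_univ, Fintype.card_fin] at h2 h3
      omega
    obtain ⟨w, hw, hS, hT⟩ := aux_split R hirr htour (P m) (((P m).card + 1) / 4)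
      (by omega) (by omega)
    have hcard := aux_card R hirr htour (P m) w hw
    set A := (P m).filter (fun u => R u w) with hA
    set B := (P m).filter (fun u => R w u) with hB
    have hwW : w ∉ W := (hcov w).1 ⟨m, hw⟩
    have hAR : ∀ x ∈ A, R x w := fun x hx => (Finset.mem_filter.1 hx).2
    have hBR : ∀ x ∈ B, R w x := fun x hx => (Finset.mem_filter.1 hx).2
    have hAP : A ⊆ P m := Finset.filter_subset _ _
    have hBP : B ⊆ P m := Finset.filter_subset _ _
    have hupd : ∀ i, Function.update P m A i ⊆ P i := by
      intro i
      by_cases h : i = m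
      · subst h; simpa using hAP
      · simp [h]
    have hdisj : ∀ i, w ∈ P i → i = m := by
      intro i hi
      by_contra hne'
      obtain ⟨z, hz, h | h⟩ := hsep i m hne'
      · have a := h.1 w hi
        have b := h.2 w hw
        by_cases e : w = z
        · subst e; exact hirr _ a
        · have := htour w z e; tauto
      · have a := h.1 w hi
        have b := h.2 w hw
        by_cases e : w = z
        · subst e; exact hirr _ a
        · have := htour w z e; tauto
    have hmB : ∀ i, ∃ z ∈ insert w W,
        ((∀ x ∈ Function.update P m A i, R x z) ∧ (∀ x ∈ B, R z x)) ∨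
        ((∀ x ∈ Function.update P m A i, R z x) ∧ (∀ x ∈ B, R x z)) := by
      intro i
      by_cases h : i = m
      · subst h
        exact ⟨w, Finset.mem_insert_self _ _, Or.inl ⟨by simpa using hAR, hBR⟩⟩
      · obtain ⟨z, hz, hh⟩ := hsep i m h
        refine ⟨z, Finset.mem_insert_of_mem hz, hh.imp ?_ ?_⟩
        · exact fun hh => ⟨fun x hx => hh.1 x (hupd i hx), fun x hx => hh.2 x (hBP hx)⟩
        · exact fun hh => ⟨fun x hx => hh.1 x (hupd i hx), fun x hx => hh.2 x (hBP hx)⟩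
    have hle : ∀ i : Fin (q + 1 + 1),
        ((Fin.cons B (Function.update P m A) : Fin (q+1+1) → Finset V) i).card ≤ (P m).card := by
      intro i
      refine Fin.cases ?_ (fun i => ?_) i
      · simpa using Finset.card_le_card hBP
      · simpa using (Finset.card_le_card (hupd i)).trans (hm i (Finset.mem_univ _))
    have hge : ∀ i : Fin (q + 1 + 1), (P m).card ≤ 9 *
        ((Fin.cons B (Function.update P m A) : Fin (q+1+1) → Finset V) i).card + 1 := by
      intro i
      refine Fin.cases ?_ (fun i => ?_) i
      · simp only [Fin.cons_zero]; omega
      · simp only [Fin.cons_succ]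
        by_cases h : i = m
        · subst h; simp only [Function.update_self]; omega
        · simp only [Function.update_of_ne h]; exact hbal m i
    refine ⟨insert w W, Fin.cons B (Function.update P m A), ?_, ?_, ?_, ?_, ?_⟩
    · rw [Finset.card_insert_of_notMem hwW, hW]
    · intro i
      rw [← Finset.card_pos]
      have := hge i
      omega
    · intro x
      rw [Fin.exists_fin_succ]
      simp only [Fin.cons_zero, Fin.cons_succ, Finset.mem_insert, not_or]
      constructor
      · rintro (hx | ⟨i, hx⟩)
        · refine ⟨?_, (hcov x).1 ⟨m, hBP hx⟩⟩
          rintro rfl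
          exact hirr _ (hBR _ hx)
        · refine ⟨?_, (hcov x).1 ⟨i, hupd i hx⟩⟩
          rintro rfl
          have := hdisj i (hupd i hx)
          subst this
          simp only [Function.update_self] at hx
          exact hirr _ (hAR _ hx)
      · rintro ⟨hxw, hxW⟩
        obtain ⟨i, hi⟩ := (hcov x).2 hxW
        by_cases h : i = m
        · subst h
          rcases htour x w hxw with h | h
          · exact Or.inr ⟨i, by simp [hA, hi, h.1]⟩
          · exact Or.inl (by simp [hB, hi, h.1])
        · exact Or.inr ⟨i, by simpa [h] using hi⟩
    · exact fun i j => (hle i).trans (hge j)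
    · intro i j
      refine Fin.cases ?_ (fun i => ?_) i <;> refine Fin.cases ?_ (fun j => ?_) j
      · simp
      · intro _
        obtain ⟨z, hz, h⟩ := hmB j
        exact ⟨z, hz, by simp only [Fin.cons_zero, Fin.cons_succ]; tauto⟩
      · intro _
        simpa only [Fin.cons_zero, Fin.cons_succ] using hmB i
      · intro hij
        obtain ⟨z, hz, h⟩ := hsep i j (fun e => hij (by rw [e]))
        refine ⟨z, Finset.mem_insert_of_mem hz, ?_⟩
        simp only [Fin.cons_succ]
        exact h.imp
          (fun h => ⟨fun x hx => h.1 x (hupd i hx), fun x hx => h.2 x (hupd j hx)⟩)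
          (fun h => ⟨fun x hx => h.1 x (hupd i hx), fun x hx => h.2 x (hupd j hx)⟩)

/-- The existence content of Lemma 3.2: for a tournament relation `R` on a finite type `V`
with `n = |V|` and an integer `q ≥ 1` with `n ≥ 30 (q + 1)`, there exist `W ⊆ V` with
`|W| = q` and pairwise disjoint nonempty sets `V_1, …, V_{q+1}` whose union is `V ∖ W`
satisfying the balance, separation and intersection properties, where `S_w = {u : R u w}`
and `T_w = {u : R w u}`. -/
theorem stmt2 {V : Type*} [Fintype V] [DecidableEq V]
    (R : V → V → Prop) [DecidableRel R]
    (hirr : ∀ v, ¬ R v v)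
    (htour : ∀ u v : V, u ≠ v → (R u v ∧ ¬ R v u) ∨ (R v u ∧ ¬ R u v))
    (q : ℕ) (hq : 1 ≤ q) (hn : 30 * (q + 1) ≤ Fintype.card V) :
    ∃ (W : Finset V) (P : Fin (q + 1) → Finset V),
      W.card = q ∧
      (∀ i, (P i).Nonempty) ∧
      (∀ i j, i ≠ j → Disjoint (P i) (P j)) ∧
      (Finset.univ.biUnion P = Finset.univ \ W) ∧
      -- (1) balance: the largest part is at most 9 times the smallest plus 1
      (∀ i j, (P i).card ≤ 9 * (P j).card + 1) ∧
      -- (2) separation: any two parts are separated by some w ∈ W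
      (∀ i j, i ≠ j → ∃ w ∈ W,
        ((∀ x ∈ P i, R x w) ∧ (∀ x ∈ P j, R w x)) ∨
        ((∀ x ∈ P i, R w x) ∧ (∀ x ∈ P j, R x w))) ∧
      -- (3) for every U ⊆ W, the cell V_U is contained in a single part
      (∀ U ⊆ W, ∃ i, ∀ v : V,
        (∀ w ∈ U, R v w) → (∀ w ∈ W \ U, R w v) → v ∈ P i) := by
  obtain ⟨W, P, hW, hne, hcov, hbal, hsep⟩ := aux_main R hirr htour q hn
  have hanti : ∀ u v, R u v → R v u → False := by
    intro u v h1 h2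
    by_cases e : u = v
    · subst e; exact hirr _ h1
    · have := htour u v e; tauto
  refine ⟨W, P, hW, hne, ?_, ?_, hbal, hsep, ?_⟩
  · intro i j hij
    rw [Finset.disjoint_left]
    intro x hi hj
    obtain ⟨w, _, h | h⟩ := hsep i j hij
    · exact hanti _ _ (h.1 x hi) (h.2 x hj)
    · exact hanti _ _ (h.1 x hi) (h.2 x hj)
  · ext x
    simpa using hcov x
  · intro U hU
    by_cases hex : ∃ v, (∀ w ∈ U, R v w) ∧ (∀ w ∈ W \ U, R w v)
    · have key : ∀ v, (∀ w ∈ U, R v w) → (∀ w ∈ W \ U, R w v) → ∃ i, v ∈ P i := by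
        intro v h1 h2
        refine (hcov v).2 fun hv => ?_
        by_cases hvU : v ∈ U
        · exact hirr _ (h1 v hvU)
        · exact hirr _ (h2 v (Finset.mem_sdiff.2 ⟨hv, hvU⟩))
      obtain ⟨v, h1, h2⟩ := hex
      obtain ⟨i, hi⟩ := key v h1 h2
      refine ⟨i, fun x hx1 hx2 => ?_⟩
      obtain ⟨j, hj⟩ := key x hx1 hx2
      by_cases hij : i = j
      · rw [hij]; exact hj
      exfalso
      obtain ⟨w, hw, h⟩ := hsep i j hij
      by_cases hwU : w ∈ U
      · rcases h with h | h
        · exact hanti _ _ (h.2 x hj) (hx1 w hwU)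
        · exact hanti _ _ (h.1 v hi) (h1 w hwU)
      · have hw' := Finset.mem_sdiff.2 ⟨hw, hwU⟩
        rcases h with h | h
        · exact hanti _ _ (h.1 v hi) (h2 w hw')
        · exact hanti _ _ (h.2 x hj) (hx2 w hw')
    · exact ⟨0, fun v h1 h2 => absurd ⟨v, h1, h2⟩ hex⟩
end

section
/- For every pair of vertices u, v ∈ V_i, d(u,v) ≤ d_{G_i^S}(u,v) + 2D' and d(u,v) ≤ d_{G_i^T}(u,v) + 2D'. (Lemma 4.3: distances in the augmented graphs underestimate distances in the original graph by at most the additive term 2D'.) -/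
open scoped ENNReal Classical

noncomputable section

/-- Total weight of a walk, given as the list of its vertices; weight `⊤` encodes a
missing edge. -/
def walkCost {α : Type*} (w : α → α → ℝ≥0∞) : List α → ℝ≥0∞
  | [] => 0
  | [_] => 0
  | a :: b :: rest => w a b + walkCost w (b :: rest)

/-- Shortest-path distance in the weighted directed graph with weight function `w`
(`w x y = ⊤` means there is no edge from `x` to `y`): the infimum over directed walks
from `u` to `v` of their total weight. -/
def spDist {α : Type*} (w : α → α → ℝ≥0∞) (u v : α) : ℝ≥0∞ :=
  ⨅ (l : List α) (_ : l.head? = some u ∧ l.getLast? = some v), walkCost w l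

/-- The augmented graph `G_i^S` on vertex set `V_i ∪ {h_S}` (`none` is the extra hub
vertex `h_S`): it keeps the edges of `G` inside `V_i`, has a weight-`0` edge from each
`u ∈ V_i` to `h_S`, and an edge from `h_S` to each `v ∈ V_i` of weight
`max 0 (min_{a ∈ W_i^S} d(a, v) − D')` whenever `W_i^S ≠ ∅` and that minimum is finite. -/
def augS {V : Type*} (wG : V → V → ℝ≥0∞) (Vi WiS : Set V) (D' : ℝ≥0∞) :
    Option V → Option V → ℝ≥0∞
  | some u, some v => if u ∈ Vi ∧ v ∈ Vi then wG u v else ⊤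
  | some u, none => if u ∈ Vi then 0 else ⊤
  | none, some v =>
      if v ∈ Vi ∧ WiS.Nonempty ∧ (⨅ a ∈ WiS, spDist wG a v) ≠ ⊤ then
        (⨅ a ∈ WiS, spDist wG a v) - D'
      else ⊤
  | none, none => ⊤

/-- The augmented graph `G_i^T` on vertex set `V_i ∪ {h_T}` (`none` is the extra hub
vertex `h_T`): it keeps the edges of `G` inside `V_i`, has a weight-`0` edge from `h_T`
to each `v ∈ V_i`, and an edge from each `u ∈ V_i` to `h_T` of weight
`max 0 (min_{a ∈ W_i^T} d(u, a) − D')` whenever `W_i^T ≠ ∅` and that minimum is finite. -/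
def augT {V : Type*} (wG : V → V → ℝ≥0∞) (Vi WiT : Set V) (D' : ℝ≥0∞) :
    Option V → Option V → ℝ≥0∞
  | some u, some v => if u ∈ Vi ∧ v ∈ Vi then wG u v else ⊤
  | none, some v => if v ∈ Vi then 0 else ⊤
  | some u, none =>
      if u ∈ Vi ∧ WiT.Nonempty ∧ (⨅ a ∈ WiT, spDist wG u a) ≠ ⊤ then
        (⨅ a ∈ WiT, spDist wG u a) - D'
      else ⊤
  | none, none => ⊤

theorem spDist_le_walk {α : Type*} (w : α → α → ℝ≥0∞) (u v : α) (l : List α)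
    (h1 : l.head? = some u) (h2 : l.getLast? = some v) : spDist w u v ≤ walkCost w l :=
  iInf₂_le l ⟨h1, h2⟩

theorem spDist_self' {α : Type*} (w : α → α → ℝ≥0∞) (u : α) : spDist w u u = 0 := by
  have := spDist_le_walk w u u [u] rfl rfl
  simpa [walkCost] using this

theorem spDist_step {α : Type*} (w : α → α → ℝ≥0∞) (u y v : α) :
    spDist w u v ≤ w u y + spDist w y v := by
  rw [← tsub_le_iff_left]
  refine le_iInf₂ fun l hl => ?_
  rw [tsub_le_iff_left]
  obtain ⟨h1, h2⟩ := hl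
  cases l with
  | nil => simp at h1
  | cons b r =>
    simp only [List.head?_cons, Option.some.injEq] at h1
    subst h1
    exact spDist_le_walk w u v (u :: b :: r) rfl (by simpa using h2)

theorem spDist_walk_add {α : Type*} (w : α → α → ℝ≥0∞) (y z : α) (l : List α) :
    ∀ x, l.head? = some x → l.getLast? = some y →
      spDist w x z ≤ walkCost w l + spDist w y z := by
  induction l with
  | nil => intro x h; simp at h
  | cons b r ih =>
    intro x h1 h2
    simp only [List.head?_cons, Option.some.injEq] at h1
    subst h1
    cases r with
    | nil =>
      simp at h2
      subst h2
      simp [walkCost]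
    | cons c r =>
      have := ih c rfl (by simpa using h2)
      calc spDist w b z ≤ w b c + spDist w c z := spDist_step w b c z
        _ ≤ w b c + (walkCost w (c :: r) + spDist w y z) := by gcongr
        _ = _ := by simp [walkCost, add_assoc]

theorem spDist_triangle' {α : Type*} (w : α → α → ℝ≥0∞) (x y z : α) :
    spDist w x z ≤ spDist w x y + spDist w y z := by
  rw [← tsub_le_iff_right]
  refine le_iInf₂ fun l hl => ?_
  rw [tsub_le_iff_right]
  exact spDist_walk_add w y z l x hl.1 hl.2

theorem augS_walk {V : Type*} (wG : V → V → ℝ≥0∞) (Vi A : Set V) (D' : ℝ≥0∞)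
    (hA : ∀ a ∈ A, ∀ x ∈ Vi, spDist wG x a ≤ D') (v : V) (l : List (Option V)) :
    l.getLast? = some (some v) →
    (∀ z ∈ Vi, spDist wG z v ≤ walkCost (augS wG Vi A D') l + 2 * D') ∨
    (∃ x, l.head? = some (some x) ∧ spDist wG x v ≤ walkCost (augS wG Vi A D') l) := by
  induction l with
  | nil => intro h; simp at h
  | cons b r ih =>
    intro h
    cases r with
    | nil =>
      simp at h
      subst h
      exact Or.inr ⟨v, rfl, by simp [spDist_self']⟩
    | cons c r =>
      rcases ih (by simpa using h) with h0 | ⟨y, hy, hyv⟩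
      · left
        intro z hz
        refine (h0 z hz).trans ?_
        gcongr
        simp [walkCost]
      · simp only [List.head?_cons, Option.some.injEq] at hy
        subst hy
        cases b with
        | some x =>
          right
          refine ⟨x, rfl, (spDist_step wG x y v).trans ?_⟩
          simp only [walkCost]
          gcongr
          simp only [augS]
          split_ifs <;> simp
        | none =>
          left
          intro z hz
          simp only [walkCost, augS]
          split_ifs with hc
          · have h1 : spDist wG z v ≤ (D' + spDist wG y v) + ⨅ a ∈ A, spDist wG a y := by
              rw [← tsub_le_iff_left]
              refine le_iInf₂ fun a ha => ?_
              rw [tsub_le_iff_left]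
              calc spDist wG z v ≤ spDist wG z a + spDist wG a v := spDist_triangle' ..
                _ ≤ D' + (spDist wG a y + spDist wG y v) := by
                  gcongr
                  · exact hA a ha z hz
                  · exact spDist_triangle' ..
                _ = _ := by ring
            refine h1.trans ?_
            calc _ ≤ (D' + walkCost (augS wG Vi A D') (some y :: r)) +
                  (((⨅ a ∈ A, spDist wG a y) - D') + D') := by
                  gcongr
                  exact le_tsub_add
              _ = _ := by ring
          · simp

theorem augT_walk {V : Type*} (wG : V → V → ℝ≥0∞) (Vi A : Set V) (D' : ℝ≥0∞)
    (v : V) (hA : ∀ a ∈ A, spDist wG a v ≤ D') (l : List (Option V)) :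
    ∀ x, l.head? = some (some x) → l.getLast? = some (some v) →
    spDist wG x v ≤ walkCost (augT wG Vi A D') l + 2 * D' := by
  induction l with
  | nil => intro x h; simp at h
  | cons b r ih =>
    intro x h1 h
    simp only [List.head?_cons, Option.some.injEq] at h1
    subst h1
    cases r with
    | nil =>
      simp at h
      subst h
      simp [spDist_self']
    | cons c r =>
      cases c with
      | some y =>
        have h0 := ih y rfl (by simpa using h)
        refine (spDist_step wG x y v).trans ?_
        simp only [walkCost]
        rw [add_assoc]
        gcongr
        simp only [augT]
        split_ifs <;> simp
      | none =>
        simp only [walkCost, augT]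
        split_ifs with hc
        · have h1 : spDist wG x v ≤ D' + ⨅ a ∈ A, spDist wG x a := by
            rw [← tsub_le_iff_left]
            refine le_iInf₂ fun a ha => ?_
            rw [tsub_le_iff_left, add_comm]
            refine (spDist_triangle' wG x a v).trans ?_
            gcongr
            exact hA a ha
          refine h1.trans ?_
          calc _ ≤ D' + (((⨅ a ∈ A, spDist wG x a) - D') + D') := by
                gcongr
                exact le_tsub_add
            _ = ((⨅ a ∈ A, spDist wG x a) - D') + 0 + 2 * D' := by ring
            _ ≤ _ := by
                gcongr
                simp
        · simp

/-- Lemma 4.3: for all `u, v ∈ V_i`, `d(u,v) ≤ d_{G_i^S}(u,v) + 2 D'` and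
`d(u,v) ≤ d_{G_i^T}(u,v) + 2 D'`. -/
theorem stmt5 {V : Type*} [Fintype V]
    (wG : V → V → ℝ≥0∞)
    (W : Set V) (D' : ℝ≥0∞) (hD'top : D' ≠ ⊤)
    (hW : ∀ a ∈ W, ∀ x : V, min (spDist wG a x) (spDist wG x a) ≤ D')
    (S T : V → Set V)
    (hSa : ∀ a ∈ W, a ∉ S a) (hTa : ∀ a ∈ W, a ∉ T a)
    (hpart : ∀ a ∈ W, ∀ u : V, u ≠ a → (u ∈ S a ∧ u ∉ T a) ∨ (u ∈ T a ∧ u ∉ S a))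
    (hS : ∀ a ∈ W, ∀ u ∈ S a, spDist wG u a ≤ spDist wG a u)
    (hT : ∀ a ∈ W, ∀ u ∈ T a, spDist wG a u ≤ spDist wG u a)
    (Vi : Set V) (hViW : Disjoint Vi W)
    (u v : V) (hu : u ∈ Vi) (hv : v ∈ Vi) :
    spDist wG u v ≤ spDist (augS wG Vi {a ∈ W | Vi ⊆ S a} D') (some u) (some v) + 2 * D' ∧
    spDist wG u v ≤ spDist (augT wG Vi {a ∈ W | Vi ⊆ T a} D') (some u) (some v) + 2 * D' := by
  constructor
  · rw [← tsub_le_iff_right]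
    refine le_iInf₂ fun l hl => ?_
    rw [tsub_le_iff_right]
    rcases augS_walk wG Vi {a ∈ W | Vi ⊆ S a} D' (fun a ha x hx => by
      have h1 := hW a ha.1 x
      rwa [min_eq_right (hS a ha.1 x (ha.2 hx))] at h1) v l hl.2 with h | ⟨x, hx, h⟩
    · exact h u hu
    · rw [hl.1] at hx
      simp only [Option.some.injEq] at hx
      subst hx
      exact h.trans le_self_add
  · rw [← tsub_le_iff_right]
    refine le_iInf₂ fun l hl => ?_
    rw [tsub_le_iff_right]
    refine augT_walk wG Vi {a ∈ W | Vi ⊆ T a} D' v (fun a ha => ?_) l u hl.1 hl.2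
    have h1 := hW a ha.1 v
    rwa [min_eq_left (hT a ha.1 v (ha.2 hv))] at h1

end
end
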